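/- Let (R,m) be a Noetherian complete local domain. Then every balanced big Cohen–Macaulay R-algebra B satisfies IB ∩ R ⊆ overline{I} for all ideals I ⊆ R. -/

import Mathlib

open IsLocalRing

universe u

section BasicDefs

variable (R : Type*) [CommRing R]

/-- The length of a module, i.e. the Krull dimension of its lattice of submodules. -/
noncomputable def moduleLength (M : Type*) [AddCommGroup M] [Module R M] : WithBot ℕ∞ :=
  Order.krullDim (Submodule R M)

/-- A system of parameters of a Noetherian local ring: `d` elements generating an
ideal whose radical is the maximal ideal, where `d` is the Krull dimension. -/
def IsSOP [IsLocalRing R] {d : ℕ} (x : Fin d → R) : Prop :=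
  ringKrullDim R = (d : WithBot ℕ∞) ∧
    (Ideal.span (Set.range x)).radical = maximalIdeal R

/-- A parameter ideal is an ideal generated by a system of parameters. -/
def IsParameterIdeal [IsLocalRing R] (Q : Ideal R) : Prop :=
  ∃ (d : ℕ) (x : Fin d → R), IsSOP R x ∧ Q = Ideal.span (Set.range x)

/-- `f : R →+* B` makes `B` a balanced big Cohen-Macaulay `R`-algebra if every system of
parameters of `R` maps to a regular sequence on `B` and `m·B ≠ B`. -/
def IsBalancedBigCMHom [IsLocalRing R] {B : Type*} [CommRing B] (f : R →+* B) : Prop :=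
  (∀ (d : ℕ) (x : Fin d → R), IsSOP R x →
      RingTheory.Sequence.IsRegular B (List.ofFn fun i => f (x i))) ∧
    (maximalIdeal R).map f ≠ ⊤

/-- A balanced big Cohen-Macaulay algebra. -/
def IsBalancedBigCM [IsLocalRing R] (B : Type*) [CommRing B] [Algebra R B] : Prop :=
  IsBalancedBigCMHom R (algebraMap R B)

/-- The integral closure of an ideal `I`, as a set: all `x` satisfying an equation
`x^n + a₁ x^{n-1} + ⋯ + aₙ = 0` with `aₖ ∈ I^k`. -/
def intClSet (I : Ideal R) : Set R :=
  { x | ∃ n : ℕ, 0 < n ∧ ∃ a : ℕ → R,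
      (∀ k ∈ Finset.Icc 1 n, a k ∈ I ^ k) ∧
      x ^ n + ∑ k ∈ Finset.Icc 1 n, a k * x ^ (n - k) = 0 }

/-- `I^B := IB ∩ R`, the contraction of the extension of `I` along `f : R →+* B`. -/
def contractedExt {B : Type*} [CommRing B] (f : R →+* B) (I : Ideal R) : Ideal R :=
  (I.map f).comap f

/-- Condition (†): `I^B ⊆ \bar I` for every m-primary ideal `I`. -/
def SatisfiesDagger [IsLocalRing R] {B : Type*} [CommRing B] (f : R →+* B) : Prop :=
  ∀ I : Ideal R, I.radical = maximalIdeal R →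
    (contractedExt R f I : Set R) ⊆ intClSet R I

/-- `e` is the family of Hilbert coefficients of the filtration `J` (in dimension `d`):
for `n ≫ 0`, `ℓ(R/J (n+1)) = ∑_{i≤d} (-1)^i e i * choose (n+d-i) (d-i)`. -/
def HasHilbertSeries (d : ℕ) (J : ℕ → Ideal R) (e : ℕ → ℤ) : Prop :=
  ∃ N : ℕ, ∀ n ≥ N, ∃ m : ℕ,
    moduleLength R (R ⧸ J (n + 1)) = (m : WithBot ℕ∞) ∧
    (m : ℤ) = ∑ i ∈ Finset.range (d + 1),
      (-1) ^ i * e i * ((n + d - i).choose (d - i) : ℤ)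

/-- Module version of `HasHilbertSeries`, for the `J`-adic filtration of a module `M`. -/
def HasHilbertSeriesMod (M : Type*) [AddCommGroup M] [Module R M] (d : ℕ)
    (J : Ideal R) (e : ℕ → ℤ) : Prop :=
  ∃ N : ℕ, ∀ n ≥ N, ∃ m : ℕ,
    moduleLength R (M ⧸ (J ^ (n + 1) • (⊤ : Submodule R M))) = (m : WithBot ℕ∞) ∧
    (m : ℤ) = ∑ i ∈ Finset.range (d + 1),
      (-1) ^ i * e i * ((n + d - i).choose (d - i) : ℤ)


/-- The limit closure `(x₁,…,x_d)^{lim} = ⋃ₜ ((x₁^{t+1},…,x_d^{t+1}) : (x₁⋯x_d)^t)`. -/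
def limitClosure {d : ℕ} (x : Fin d → R) : Ideal R :=
  ⨆ t : ℕ, (Ideal.span (Set.range fun i => x i ^ (t + 1))).colon
    (Ideal.span {(∏ i, x i) ^ t})

/-- A ring is equidimensional if `dim (R/P) = dim R` for every minimal prime `P`. -/
def IsEquidimensional : Prop :=
  ∀ P ∈ minimalPrimes R, ringKrullDim (R ⧸ P) = ringKrullDim R

/-- Depth at least `n`: there is a regular sequence of length `n` in the
(Jacobson) radical, i.e. in the maximal ideal when `R` is local. -/
def HasDepthGE (n : ℕ) : Prop :=
  ∃ rs : List R, rs.length = n ∧ (∀ r ∈ rs, r ∈ (⊥ : Ideal R).jacobson) ∧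
    RingTheory.Sequence.IsRegular R rs

/-- A Cohen-Macaulay (Noetherian) local ring: depth = dimension. -/
def IsCohenMacaulayLocalRing : Prop :=
  IsLocalRing R ∧ IsNoetherianRing R ∧
    ∃ d : ℕ, ringKrullDim R = (d : WithBot ℕ∞) ∧ HasDepthGE R d

/-- Serre's condition S₂: for every prime `P`,
`depth R_P ≥ min 2 (dim R_P)`. -/
def SerreS2 : Prop :=
  ∀ (P : Ideal R) (hP : P.IsPrime) (n : ℕ),
    (n : WithBot ℕ∞) ≤ min 2 (ringKrullDim (Localization.AtPrime P)) →
    HasDepthGE (Localization.AtPrime P) n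

/-- A regular local ring: a Noetherian local ring whose maximal ideal is generated
by `dim R` elements. -/
def IsRegularLocal : Prop :=
  IsLocalRing R ∧ IsNoetherianRing R ∧ ∃ (d : ℕ) (x : Fin d → R),
    ringKrullDim R = (d : WithBot ℕ∞) ∧
      Ideal.span (Set.range x) = (⊥ : Ideal R).jacobson

/-- A regular (not necessarily local) ring: Noetherian and all localizations at
primes are regular local rings. -/
def IsRegularNoethRing : Prop :=
  IsNoetherianRing R ∧
    ∀ (P : Ideal R) (hP : P.IsPrime), IsRegularLocal (Localization.AtPrime P)

/-- The tight closure of an ideal `I` in characteristic `p`, as a set. -/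
def tightClSet (p : ℕ) (I : Ideal R) : Set R :=
  { x | ∃ c : R, (∀ P ∈ minimalPrimes R, c ∉ P) ∧
      ∃ E : ℕ, ∀ e ≥ E, c * x ^ p ^ e ∈ Ideal.span ((fun a => a ^ p ^ e) '' (I : Set R)) }

/-- F-rationality: every parameter ideal is tightly closed. -/
def IsFRational [IsLocalRing R] (p : ℕ) : Prop :=
  ∀ Q : Ideal R, IsParameterIdeal R Q → tightClSet R p Q ⊆ (Q : Set R)

end BasicDefs

section Excellence

open TensorProduct

/-- Geometrically regular `k`-algebra (for `k` a field): `L ⊗[k] A` is regular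
for every finite field extension `L` of `k`. -/
def IsGeometricallyRegular (k : Type u) (A : Type u) [CommRing k] [CommRing A]
    [Algebra k A] : Prop :=
  ∀ (L : Type u) [Field L] [Algebra k L], Module.Finite k L → IsRegularNoethRing (L ⊗[k] A)

/-- `R` is a G-ring: for every prime `p`, the fibers of
`R_p → (R_p)^∧` are geometrically regular. -/
def IsGRing (R : Type u) [CommRing R] : Prop :=
  ∀ (p : Ideal R) (hp : p.IsPrime) (q : Ideal (Localization.AtPrime p)) (hq : q.IsPrime),
    IsGeometricallyRegular
      (ResidueField (Localization.AtPrime q))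
      ((ResidueField (Localization.AtPrime q))
        ⊗[Localization.AtPrime p]
        AdicCompletion (maximalIdeal (Localization.AtPrime p)) (Localization.AtPrime p))

/-- `R` is J-2: the regular locus of every finitely generated `R`-algebra is open. -/
def IsJ2 (R : Type u) [CommRing R] : Prop :=
  ∀ (A : Type u) [CommRing A] [Algebra R A], Algebra.FiniteType R A →
    IsOpen { P : PrimeSpectrum A | IsRegularLocal (Localization.AtPrime P.asIdeal) }

/-- A catenary ring: any two saturated chains of primes with the same endpoints
have the same length. -/
def IsCatenary (A : Type*) [CommRing A] : Prop :=
  ∀ c₁ c₂ : LTSeries (PrimeSpectrum A),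
    c₁.head = c₂.head → c₁.last = c₂.last →
    (∀ i : Fin c₁.length, c₁.toFun i.castSucc ⋖ c₁.toFun i.succ) →
    (∀ i : Fin c₂.length, c₂.toFun i.castSucc ⋖ c₂.toFun i.succ) →
    c₁.length = c₂.length

/-- Universally catenary: every finitely generated `R`-algebra is catenary. -/
def IsUniversallyCatenary (R : Type u) [CommRing R] : Prop :=
  ∀ (A : Type u) [CommRing A] [Algebra R A], Algebra.FiniteType R A → IsCatenary A

/-- An excellent ring: Noetherian, a G-ring, J-2 and universally catenary. -/
def IsExcellentRing (R : Type u) [CommRing R] : Prop :=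
  IsNoetherianRing R ∧ IsGRing R ∧ IsJ2 R ∧ IsUniversallyCatenary R

end Excellence

/-- `R` is BCM_B-rational (in dimension `d`): Cohen-Macaulay and the natural map
`H^d_m(R) → H^d_m(B)` is injective. -/
def IsBCMRational (R : Type u) [CommRing R] [IsLocalRing R]
    (B : Type u) [CommRing B] [Algebra R B] (d : ℕ) : Prop :=
  IsCohenMacaulayLocalRing R ∧
    Function.Injective
      ((localCohomology (maximalIdeal R) d).map (ModuleCat.ofHom (Algebra.linearMap R B)))

namespace BCM

lemma mem_smul_top_pi {R : Type*} [CommRing R] (J : Ideal R) (n : ℕ) (f : Fin n → R) :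
    f ∈ (J • ⊤ : Submodule R (Fin n → R)) ↔ ∀ i, f i ∈ J := by
  constructor
  · intro h i
    refine Submodule.smul_induction_on (p := fun f : Fin n → R => f i ∈ J) h ?_ ?_
    · intro r hr v _
      exact J.mul_mem_right _ hr
    · intro a b ha hb
      exact J.add_mem ha hb
  · intro h
    have : f = ∑ i, f i • (Pi.single i (1 : R) : Fin n → R) := by
      ext j
      simp [Finset.sum_apply, Pi.single_apply]
    rw [this]
    exact Submodule.sum_mem _ fun i _ => Submodule.smul_mem_smul (h i) trivial

lemma precomplete_pi {R : Type*} [CommRing R] (J : Ideal R) [IsPrecomplete J R] (n : ℕ) :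
    IsPrecomplete J (Fin n → R) := by
  constructor
  intro f hf
  have key : ∀ i : Fin n, ∃ L : R, ∀ m, f m i ≡ L [SMOD (J ^ m • ⊤ : Submodule R R)] := by
    intro i
    apply IsPrecomplete.prec ‹IsPrecomplete J R›
    intro a b hab
    have := hf hab
    rw [SModEq.sub_mem, mem_smul_top_pi] at this
    rw [SModEq.sub_mem]
    simpa using this i
  choose L hL using key
  refine ⟨L, fun m => ?_⟩
  rw [SModEq.sub_mem, mem_smul_top_pi]
  intro i
  have := hL i m
  rw [SModEq.sub_mem] at this
  simpa using this

/-- Nakayama over a complete ring. -/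
lemma finite_of_complete {R : Type*} [CommRing R] (J : Ideal R) [IsPrecomplete J R]
    {N : Type*} [AddCommGroup N] [Module R N] [IsHausdorff J N]
    (h : Module.Finite R (N ⧸ (J • ⊤ : Submodule R N))) : Module.Finite R N := by
  obtain ⟨n, g, hg⟩ := Module.Finite.exists_fin' R (N ⧸ (J • ⊤ : Submodule R N))
  obtain ⟨f, hf⟩ := Module.projective_lifting_property (Submodule.mkQ (J • ⊤ : Submodule R N)) g
    (Submodule.mkQ_surjective _)
  have := precomplete_pi J n
  have : Function.Surjective f := surjective_of_mkQ_comp_surjective (I := J) (by rw [hf]; exact hg)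
  exact Module.Finite.of_surjective f this

section Tate
variable {R : Type*} [CommRing R] {W : Type*} [AddCommGroup W] [Module R W] {d : ℕ}

/-- Partially truncated iterated Tate modules. -/
def tate (x : Fin d → R) (W : Type*) [AddCommGroup W] [Module R W] (S : Finset (Fin d)) :
    Submodule R ((Fin d → ℕ) → W) where
  carrier := {w | (∀ i ∈ S, ∀ n, x i • w n = 0 ∧ (n i ≠ 1 → w n = 0)) ∧
    (∀ i ∉ S, ∀ n, (n i = 0 → w n = 0) ∧ x i • w (n + Pi.single i 1) = w n)}
  add_mem' := by
    rintro a b ⟨ha, ha'⟩ ⟨hb, hb'⟩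
    refine ⟨fun i hi n => ⟨?_, fun h => ?_⟩, fun i hi n => ⟨fun h => ?_, ?_⟩⟩
    · simp [(ha i hi n).1, (hb i hi n).1]
    · simp [(ha i hi n).2 h, (hb i hi n).2 h]
    · simp [(ha' i hi n).1 h, (hb' i hi n).1 h]
    · simp [(ha' i hi n).2, (hb' i hi n).2]
  zero_mem' := by simp
  smul_mem' := by
    rintro r a ⟨ha, ha'⟩
    refine ⟨fun i hi n => ⟨?_, fun h => ?_⟩, fun i hi n => ⟨fun h => ?_, ?_⟩⟩
    · simp [smul_comm _ r, (ha i hi n).1]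
    · simp [(ha i hi n).2 h]
    · simp [(ha' i hi n).1 h]
    · simp [smul_comm _ r, (ha' i hi n).2]

lemma tate_pow_smul (x : Fin d → R) (S : Finset (Fin d)) {w : (Fin d → ℕ) → W}
    (hw : w ∈ tate x W S) (i : Fin d) (n : Fin d → ℕ) : x i ^ (n i) • w n = 0 := by
  by_cases hi : i ∈ S
  · by_cases h1 : n i = 1
    · rw [h1, pow_one]; exact (hw.1 i hi n).1
    · rw [(hw.1 i hi n).2 h1, smul_zero]
  · generalize hk : n i = k
    induction k generalizing n with
    | zero => rw [(hw.2 i hi n).1 hk, smul_zero]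
    | succ k ih =>
      have hn : n = Function.update n i k + Pi.single i 1 := by
        ext j
        by_cases hj : j = i
        · subst hj; simp [hk]
        · simp [hj]
      rw [hn, pow_succ, mul_smul, (hw.2 i hi _).2]
      exact ih _ (by simp)

lemma tate_hausdorff [IsNoetherianRing R] (J : Ideal R) (x : Fin d → R)
    (hJ : J ≤ (Ideal.span (Set.range x)).radical) (S : Finset (Fin d)) :
    IsHausdorff J (tate x W S) := by
  constructor
  intro w hw
  ext n
  have h1 : J ≤ (Ideal.span (Set.range fun i => x i ^ n i)).radical := by
    refine hJ.trans ?_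
    rw [← Ideal.radical_idem (Ideal.span (Set.range fun i => x i ^ n i))]
    apply Ideal.radical_mono
    rw [Ideal.span_le]
    rintro _ ⟨i, rfl⟩
    exact ⟨n i, Ideal.subset_span ⟨i, rfl⟩⟩
  obtain ⟨s, hs⟩ := Ideal.exists_pow_le_of_le_radical_of_fg h1 (IsNoetherian.noetherian J)
  have h2 : ∀ v : tate x W S, ∀ r ∈ J ^ s, r • (v.1 n) = 0 := by
    intro v r hr
    have := hs hr
    refine Submodule.span_induction (p := fun r _ => r • v.1 n = 0) ?_ ?_ ?_ ?_ this
    · rintro _ ⟨i, rfl⟩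
      exact tate_pow_smul x S v.2 i n
    · simp
    · intro a b _ _ ha hb; rw [add_smul, ha, hb, add_zero]
    · intro a b _ hb; rw [smul_assoc, hb, smul_zero]
  have h3 := hw s
  rw [SModEq.zero] at h3
  refine Submodule.smul_induction_on (p := fun v : tate x W S => v.1 n = 0) h3 ?_ ?_
  · intro r hr v _
    exact h2 v r hr
  · intro a b ha hb
    change a.1 n + b.1 n = 0
    rw [ha, hb, add_zero]

/-- restriction to the slice `n i = 1`. -/
def tateRes (x : Fin d → R) (S : Finset (Fin d)) (i : Fin d) (hi : i ∉ S) :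
    tate x W S →ₗ[R] tate x W (insert i S) where
  toFun w := ⟨fun n => if n i = 1 then w.1 n else 0, by
    obtain ⟨w, hw, hw'⟩ := w
    refine ⟨fun j hj n => ?_, fun j hj n => ?_⟩
    · dsimp only
      rcases Finset.mem_insert.1 hj with rfl | hj
      · refine ⟨?_, fun h => by rw [if_neg h]⟩
        split_ifs with h1
        · have hn : n = Function.update n j 0 + Pi.single j 1 := by
            ext k
            by_cases hk : k = j
            · subst hk; simp [h1]
            · simp [hk]
          rw [hn, (hw' j hi _).2]
          exact (hw' j hi _).1 (by simp)
        · simp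
      · refine ⟨?_, fun h => ?_⟩
        · split_ifs
          · exact (hw j hj n).1
          · simp
        · split_ifs
          · exact (hw j hj n).2 h
          · rfl
    · dsimp only
      have hji : j ≠ i := fun h => hj (by simp [h])
      have hjS : j ∉ S := fun h => hj (by simp [h])
      have : (n + Pi.single j 1 : Fin d → ℕ) i = n i := by simp [hji.symm]
      rw [this]
      refine ⟨fun h => ?_, ?_⟩
      · split_ifs
        · exact (hw' j hjS n).1 h
        · rfl
      · split_ifs
        · exact (hw' j hjS n).2
        · simp⟩
  map_add' a b := by
    ext n
    simp only [Submodule.coe_add, Pi.add_apply]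
    split_ifs <;> simp
  map_smul' r a := by
    ext n
    simp only [Submodule.coe_smul, Pi.smul_apply, RingHom.id_apply]
    split_ifs <;> simp

lemma tateRes_ker (x : Fin d → R) (S : Finset (Fin d)) (i : Fin d) (hi : i ∉ S)
    (w : tate x W S) (hw : tateRes x S i hi w = 0) : ∃ v : tate x W S, w = x i • v := by
  obtain ⟨w, h1, h2⟩ := w
  have h0 : ∀ n : Fin d → ℕ, n i = 1 → w n = 0 := by
    intro n hn
    have := congrFun (congrArg Subtype.val hw) n
    simpa [tateRes, hn] using this
  refine ⟨⟨fun n => w (n + Pi.single i 1), fun j hj n => ?_, fun j hj n => ?_⟩, ?_⟩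
  · have hji : j ≠ i := fun h => hi (h ▸ hj)
    refine ⟨(h1 j hj _).1, fun h => (h1 j hj _).2 (by simpa [hji] using h)⟩
  · refine ⟨fun h => ?_, ?_⟩
    · by_cases hji : j = i
      · subst hji
        exact h0 _ (by simp [h])
      · exact (h2 j hj _).1 (by simpa [hji] using h)
    · dsimp only
      rw [add_right_comm]
      exact (h2 j hj _).2
  · ext n
    exact (h2 i hi n).2.symm

lemma tate_finite [IsNoetherianRing R] (J : Ideal R) [IsPrecomplete J R] (x : Fin d → R)
    (hJ : J ≤ (Ideal.span (Set.range x)).radical) (hx : ∀ i, x i ∈ J)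
    (hbase : Module.Finite R (tate x W Finset.univ)) : Module.Finite R (tate x W ∅) := by
  have key : ∀ k : ℕ, ∀ S : Finset (Fin d), (Sᶜ).card = k → Module.Finite R (tate x W S) := by
    intro k
    induction k with
    | zero =>
      intro S hS
      have : S = Finset.univ := by simpa using hS
      rw [this]; exact hbase
    | succ k ih =>
      intro S hS
      have hne : (Sᶜ).Nonempty := by
        rw [← Finset.card_pos]; omega
      obtain ⟨i, hi⟩ := hne
      have hi' : i ∉ S := by simpa using hi
      have h1 : Module.Finite R (tate x W (insert i S)) := by
        apply ih
        rw [Finset.compl_insert, Finset.card_erase_of_mem hi]; omega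
      have := tate_hausdorff (W := W) J x hJ S
      apply finite_of_complete J
      let ρ := tateRes (W := W) x S i hi'
      have h2 : LinearMap.ker ρ ≤ (J • ⊤ : Submodule R (tate x W S)) := by
        intro w hw
        obtain ⟨v, rfl⟩ := tateRes_ker x S i hi' w hw
        exact Submodule.smul_mem_smul (hx i) trivial
      have : Module.Finite R (LinearMap.range ρ) := inferInstance
      have : Module.Finite R (tate x W S ⧸ LinearMap.ker ρ) :=
        Module.Finite.equiv ρ.quotKerEquivRange.symm
      exact Module.Finite.of_surjective (Submodule.factor h2) (Submodule.factor_surjective h2)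
  exact key _ _ rfl

end Tate
end BCM

namespace BCM
open CategoryTheory in
lemma exists_W (R : Type u) [CommRing R] [IsLocalRing R] :
    ∃ (W : Type u) (_ : AddCommGroup W) (_ : Module R W) (e : W), e ≠ 0 ∧
      (∀ v : W, (∀ r ∈ maximalIdeal R, r • v = 0) → v ∈ Submodule.span R {e}) ∧
      (∀ (L : Type u) [AddCommGroup L] [Module R L] (D : Submodule R L) (η : L), η ∉ D →
        ∃ Ψ : L →ₗ[R] W, (∀ z ∈ D, Ψ z = 0) ∧ Ψ η = e) := by
  obtain ⟨⟨J, hJ, f, hf⟩⟩ := EnoughInjectives.presentation (ModuleCat.of R (ResidueField R))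
  have hJ' : Module.Injective R J := Module.injective_module_of_injective_object R J
  have finj : Function.Injective f.hom := (ModuleCat.mono_iff_injective f).mp hf
  let e0 : J := f.hom (1 : ResidueField R)
  have he0 : e0 ≠ 0 := by
    intro h
    have : (1 : ResidueField R) = 0 := finj (by rw [map_zero]; exact h)
    exact one_ne_zero this
  have hme0 : ∀ r ∈ maximalIdeal R, r • e0 = 0 := by
    intro r hr
    change r • f.hom (1 : ResidueField R) = 0
    rw [← map_smul]
    have : r • (1 : ResidueField R) = 0 := by
      rw [Algebra.smul_def, mul_one]
      exact (residue_eq_zero_iff r).2 hr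
    erw [this]
    exact map_zero _
  obtain ⟨K, -, hK⟩ := zorn_le_nonempty₀ {K : Submodule R J | e0 ∉ K} (by
    intro c hc hch y hy
    refine ⟨sSup c, ?_, fun z hz => le_sSup hz⟩
    intro h
    rw [Submodule.mem_sSup_of_directed ⟨y, hy⟩ hch.directedOn] at h
    obtain ⟨z, hz, h⟩ := h
    exact hc hz h) ⊥ (by simpa using he0)
  have hKe : e0 ∉ K := hK.1
  have hne : K.mkQ e0 ≠ 0 := by simpa using hKe
  refine ⟨J ⧸ K, inferInstance, inferInstance, K.mkQ e0, hne, ?_, ?_⟩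
  · intro v hv
    obtain ⟨j, rfl⟩ := K.mkQ_surjective v
    by_cases hj : j ∈ K
    · have : K.mkQ j = 0 := by simpa using hj
      rw [this]; exact zero_mem _
    · have : e0 ∈ K ⊔ Submodule.span R {j} := by
        by_contra hcon
        have := hK.2 (y := K ⊔ Submodule.span R {j}) hcon le_sup_left
        exact hj (this (Submodule.mem_sup_right (Submodule.mem_span_singleton_self j)))
      obtain ⟨k, hk, z, hz, hkz⟩ := Submodule.mem_sup.1 this
      obtain ⟨r, rfl⟩ := Submodule.mem_span_singleton.1 hz
      have h1 : K.mkQ e0 = r • K.mkQ j := by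
        rw [← hkz, map_add, map_smul]
        have : K.mkQ k = 0 := by simpa using hk
        rw [this, zero_add]
      have hr : IsUnit r := by
        by_contra hr
        exact hne (h1.trans (hv r hr))
      obtain ⟨u, rfl⟩ := hr
      rw [Submodule.mem_span_singleton]
      refine ⟨(↑u⁻¹ : R), ?_⟩
      rw [h1, smul_smul, Units.inv_mul, one_smul]
  · intro L _ _ D η hη
    let g : R →ₗ[R] (L ⧸ D) := LinearMap.toSpanSingleton R _ (D.mkQ η)
    let q : R →ₗ[R] J := LinearMap.toSpanSingleton R _ e0
    have hle : LinearMap.ker g ≤ LinearMap.ker q := by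
      intro r hr
      have hr' : r • D.mkQ η = 0 := hr
      have : r ∈ maximalIdeal R := by
        by_contra hu
        have hu : IsUnit r := by simpa using hu
        rw [hu.smul_eq_zero] at hr'
        exact hη (by simpa using hr')
      exact hme0 r this
    let g' := (LinearMap.ker g).liftQ g le_rfl
    have hg' : Function.Injective g' := by
      rw [← LinearMap.ker_eq_bot]
      exact Submodule.ker_liftQ_eq_bot _ _ _ le_rfl
    obtain ⟨h, hh⟩ := Module.Injective.extension_property R J _ _ g' hg'
      ((LinearMap.ker g).liftQ q hle)
    refine ⟨K.mkQ ∘ₗ h ∘ₗ D.mkQ, ?_, ?_⟩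
    · intro z hz
      have : D.mkQ z = 0 := by simpa using hz
      simp only [LinearMap.comp_apply, this, map_zero]
    · have h1 : g' ((LinearMap.ker g).mkQ 1) = D.mkQ η := by
        change (1 : R) • D.mkQ η = _
        rw [one_smul]
      have h2 := congrArg (fun φ => φ ((LinearMap.ker g).mkQ 1)) hh
      simp only [LinearMap.comp_apply] at h2 ⊢
      rw [h1] at h2
      rw [h2]
      congr 1
      change (1 : R) • e0 = e0
      rw [one_smul]

lemma fg_of_pow_smul {R : Type*} [CommRing R] [IsNoetherianRing R] (m : Ideal R)
    {W : Type*} [AddCommGroup W] [Module R W] (e : W)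
    (he : ∀ v : W, (∀ r ∈ m, r • v = 0) → v ∈ Submodule.span R {e}) (s : ℕ) :
    ∀ P : Submodule R W, m ^ s • P = ⊥ → P.FG := by
  induction s with
  | zero =>
    intro P hP
    have : P = ⊥ := by simpa using hP
    rw [this]; exact Submodule.fg_bot
  | succ s ih =>
    intro P hP
    have h1 : (m • P).FG := ih _ (by rw [← Submodule.mul_smul, ← pow_succ, hP])
    have h1' : Module.Finite R (m • P : Submodule R W) := Module.Finite.iff_fg.2 h1
    obtain ⟨G, hG⟩ := IsNoetherian.noetherian m
    have hGm : ∀ g ∈ G, g ∈ m := fun g hg => hG ▸ Submodule.subset_span hg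
    let f : P →ₗ[R] (G → (m • P : Submodule R W)) := LinearMap.pi fun g =>
      LinearMap.codRestrict (m • P) (g.1 • P.subtype) fun p =>
        Submodule.smul_mem_smul (hGm g.1 g.2) p.2
    have hker : LinearMap.ker f ≤ (Submodule.span R {e}).comap P.subtype := by
      intro p hp
      apply he
      intro r hr
      rw [← hG] at hr
      refine Submodule.span_induction (p := fun r _ => r • P.subtype p = 0) ?_ ?_ ?_ ?_ hr
      · intro g hg
        have := congrFun (LinearMap.mem_ker.1 hp) ⟨g, hg⟩
        exact congrArg Subtype.val this
      · simp
      · intro a b _ _ ha hb; rw [add_smul, ha, hb, add_zero]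
      · intro a b _ hb; rw [smul_assoc, hb, smul_zero]
    have hN : IsNoetherian R (LinearMap.ker f) := by
      let ι : LinearMap.ker f →ₗ[R] Submodule.span R {e} :=
        LinearMap.codRestrict _ (P.subtype ∘ₗ (LinearMap.ker f).subtype) fun p => hker p.2
      refine isNoetherian_of_injective ι ?_
      intro a b hab
      have := congrArg Subtype.val hab
      exact Subtype.ext (Subtype.ext this)
    have : IsNoetherian R P := isNoetherian_of_range_eq_ker (LinearMap.ker f).subtype f (by simp)
    exact (isNoetherian_submodule.1 this) P le_rfl

lemma tate_base {R : Type*} [CommRing R] [IsNoetherianRing R] (m : Ideal R)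
    {W : Type*} [AddCommGroup W] [Module R W] (e : W)
    (he : ∀ v : W, (∀ r ∈ m, r • v = 0) → v ∈ Submodule.span R {e})
    {d : ℕ} (x : Fin d → R) (hm : m ≤ (Ideal.span (Set.range x)).radical) :
    Module.Finite R (tate x W Finset.univ) := by
  let ev : tate x W Finset.univ →ₗ[R] W :=
    LinearMap.proj (fun _ => 1) ∘ₗ (tate x W Finset.univ).subtype
  have hev : Function.Injective ev := by
    rw [← LinearMap.ker_eq_bot, LinearMap.ker_eq_bot']
    intro w hw
    ext n
    by_cases hn : ∃ i, n i ≠ 1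
    · obtain ⟨i, hi⟩ := hn
      exact (w.2.1 i (Finset.mem_univ i) n).2 hi
    · push Not at hn
      have : n = fun _ => 1 := funext hn
      rw [this]; exact hw
  obtain ⟨s, hs⟩ := Ideal.exists_pow_le_of_le_radical_of_fg hm (IsNoetherian.noetherian m)
  have hfg : (LinearMap.range ev).FG := by
    apply fg_of_pow_smul m e he s
    rw [eq_bot_iff, Submodule.smul_le]
    rintro r hr _ ⟨w, rfl⟩
    refine Submodule.span_induction (p := fun r _ => r • ev w ∈ (⊥ : Submodule R W)) ?_ ?_ ?_ ?_ (hs hr)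
    · rintro _ ⟨i, rfl⟩
      exact (w.2.1 i (Finset.mem_univ i) _).1
    · simp
    · intro a b _ _ ha hb; rw [add_smul]; exact add_mem ha hb
    · intro a b _ hb; rw [smul_assoc]; exact Submodule.smul_mem _ _ hb
  have : Module.Finite R (LinearMap.range ev) := Module.Finite.iff_fg.2 hfg
  exact Module.Finite.equiv (LinearEquiv.ofInjective ev hev).symm

end BCM

namespace BCM

lemma exists_sop (R : Type*) [CommRing R] [IsLocalRing R] [IsNoetherianRing R] :
    ∃ (d : ℕ) (x : Fin d → R), IsSOP R x := by
  obtain ⟨s, hs, hc⟩ := Ideal.exists_finset_card_eq_height_of_isNoetherianRing (maximalIdeal R)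
  refine ⟨s.card, fun i => (s.equivFin.symm i : R), ?_, ?_⟩
  · rw [← IsLocalRing.maximalIdeal_height_eq_ringKrullDim, ← hc]
    rfl
  · have hr : Set.range (fun i => (s.equivFin.symm i : R)) = (s : Set R) := by
      ext r
      constructor
      · rintro ⟨i, rfl⟩
        exact (s.equivFin.symm i).2
      · intro h
        exact ⟨s.equivFin ⟨r, h⟩, by simp⟩
    rw [hr]
    apply le_antisymm
    · exact (Ideal.IsPrime.radical_le_iff inferInstance).2 hs.1.2
    · rw [Ideal.radical_eq_sInf]
      apply le_sInf
      rintro P ⟨hP, hP'⟩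
      exact hs.2 ⟨hP', hP⟩ (le_maximalIdeal hP'.ne_top)

lemma exists_sop_snoc (R : Type*) [CommRing R] [IsLocalRing R] [IsNoetherianRing R] [IsDomain R]
    (c : R) (hc : c ≠ 0) (hcm : c ∈ maximalIdeal R) :
    ∃ (d : ℕ) (z : Fin d → R), IsSOP R (Fin.snoc (α := fun _ => R) z c : Fin (d + 1) → R) := by
  have hne : Ideal.span {c} ≠ ⊤ := by
    intro h
    exact (maximalIdeal R).ne_top_iff_one.1 Ideal.IsPrime.ne_top'
      ((Ideal.span_singleton_le_iff_mem _).2 hcm (h ▸ trivial))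
  have : Nontrivial (R ⧸ Ideal.span {c}) := Ideal.Quotient.nontrivial_iff.2 hne
  have hloc : IsLocalRing (R ⧸ Ideal.span {c}) :=
    IsLocalRing.of_surjective' (Ideal.Quotient.mk _) Ideal.Quotient.mk_surjective
  obtain ⟨d, y, hd, hy⟩ := exists_sop (R ⧸ Ideal.span {c})
  choose z hz using fun i => Ideal.Quotient.mk_surjective (y i)
  have hdim := ringKrullDim_quotient_span_singleton_succ_eq_ringKrullDim_of_mem_nonZeroDivisors
    (mem_nonZeroDivisors_of_ne_zero hc) hcm
  have hzm : ∀ i, z i ∈ maximalIdeal R := by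
    intro i
    have : y i ∈ maximalIdeal (R ⧸ Ideal.span {c}) := by
      rw [← hy]; exact Ideal.le_radical (Ideal.subset_span ⟨i, rfl⟩)
    rw [← hz i] at this
    rw [mem_maximalIdeal, mem_nonunits_iff] at this ⊢
    exact fun h => this (h.map _)
  refine ⟨d, z, ?_, ?_⟩
  · rw [← hdim, hd]; rfl
  · apply le_antisymm
    · apply (Ideal.IsPrime.radical_le_iff inferInstance).2
      rw [Ideal.span_le]
      rintro _ ⟨i, rfl⟩
      refine Fin.lastCases ?_ (fun i => ?_) i
      · simpa using hcm
      · simpa using hzm i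
    · intro r hr
      have h1 : Ideal.Quotient.mk (Ideal.span {c}) r ∈ maximalIdeal (R ⧸ Ideal.span {c}) := by
        rw [mem_maximalIdeal, mem_nonunits_iff]
        have : IsLocalHom (Ideal.Quotient.mk (Ideal.span {c})) :=
          IsLocalHom.of_surjective _ Ideal.Quotient.mk_surjective
        intro h
        exact hr (isUnit_of_map_unit _ _ h)
      rw [← hy] at h1
      obtain ⟨n, hn⟩ := h1
      refine ⟨n, ?_⟩
      have h2 : Ideal.span (Set.range y) = (Ideal.span (Set.range z)).map
          (Ideal.Quotient.mk (Ideal.span {c})) := by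
        rw [Ideal.map_span, ← Set.range_comp]
        congr 2
        ext i; exact (hz i).symm
      rw [h2, ← map_pow, ← Ideal.mem_comap,
        Ideal.comap_map_of_surjective _ Ideal.Quotient.mk_surjective] at hn
      have h3 : Ideal.comap (Ideal.Quotient.mk (Ideal.span {c})) ⊥ = Ideal.span {c} := by
        rw [← RingHom.ker_eq_comap_bot, Ideal.mk_ker]
      rw [h3] at hn
      have h4 : Ideal.span (Set.range z) ⊔ Ideal.span {c} ≤ Ideal.span (Set.range (Fin.snoc (α := fun _ => R) z c : Fin (d + 1) → R)) := by
        refine sup_le (Ideal.span_mono ?_) (Ideal.span_mono ?_)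
        · rintro _ ⟨i, rfl⟩
          exact ⟨i.castSucc, by simp⟩
        · rintro _ rfl
          exact ⟨Fin.last d, by simp⟩
      exact h4 hn

section
variable {R : Type*} [CommRing R] [IsLocalRing R] {B : Type*} [CommRing B] [Algebra R B]


lemma reg_last (hB : IsBalancedBigCM R B) {d : ℕ} (z : Fin d → R) (c : R)
    (hz : IsSOP R (Fin.snoc (α := fun _ => R) z c : Fin (d + 1) → R)) (b : B)
    (hb : algebraMap R B c * b ∈ Ideal.span (Set.range fun i => algebraMap R B (z i))) :
    b ∈ Ideal.span (Set.range fun i => algebraMap R B (z i)) := by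
  have h := (hB.1 _ _ hz).toIsWeaklyRegular
  have hl : (List.ofFn fun i : Fin d => algebraMap R B
      ((Fin.snoc (α := fun _ => R) z c : Fin (d + 1) → R) i.castSucc)) =
      List.ofFn fun i => algebraMap R B (z i) := by
    congr; funext i; simp
  have hl2 : (List.ofFn fun i : Fin (d + 1) => algebraMap R B
      ((Fin.snoc (α := fun _ => R) z c : Fin (d + 1) → R) i)) =
      (List.ofFn fun i => algebraMap R B (z i)) ++ [algebraMap R B c] := by
    rw [List.ofFn_succ', List.concat_eq_append, hl, Fin.snoc_last]
  rw [hl2, RingTheory.Sequence.isWeaklyRegular_append_iff,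
    RingTheory.Sequence.isWeaklyRegular_singleton_iff] at h
  have h2 := h.2
  have e : (Ideal.ofList (List.ofFn fun i => algebraMap R B (z i)) • ⊤ : Submodule B B)
      = Ideal.span (Set.range fun i => algebraMap R B (z i)) := by
    rw [smul_eq_mul, Ideal.mul_top, Ideal.ofList]
    congr 1
    ext r
    simp [List.mem_ofFn]
  rw [← e] at hb ⊢
  rw [← Submodule.Quotient.mk_eq_zero] at hb ⊢
  apply h2
  change algebraMap R B c • _ = algebraMap R B c • _
  rw [smul_zero, ← Submodule.Quotient.mk_smul]
  exact hb

lemma reg_any (hB : IsBalancedBigCM R B) {d : ℕ} (x : Fin d → R) (hx : IsSOP R x) (i : Fin d)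
    (b : B)
    (hb : algebraMap R B (x i) * b ∈ Ideal.span ((fun j => algebraMap R B (x j)) '' {i}ᶜ)) :
    b ∈ Ideal.span ((fun j => algebraMap R B (x j)) '' {i}ᶜ) := by
  obtain _ | d := d
  · exact i.elim0
  have e : ((fun j => algebraMap R B (x j)) '' {i}ᶜ) =
      Set.range fun j => algebraMap R B (x (i.succAbove j)) := by
    rw [← Fin.range_succAbove, ← Set.range_comp]; rfl
  rw [e] at hb ⊢
  refine reg_last hB (fun j => x (i.succAbove j)) (x i) ⟨hx.1, ?_⟩ b hb
  rw [← hx.2]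
  congr 2
  ext r
  constructor
  · rintro ⟨j, rfl⟩
    refine Fin.lastCases ?_ (fun j => ?_) j
    · exact ⟨i, by simp⟩
    · exact ⟨i.succAbove j, by simp⟩
  · rintro ⟨j, rfl⟩
    rcases Fin.eq_self_or_eq_succAbove i j with rfl | ⟨k, rfl⟩
    · exact ⟨Fin.last d, by simp⟩
    · exact ⟨k.castSucc, by simp⟩

lemma sop_pow {d : ℕ} (x : Fin d → R) (hx : IsSOP R x) (a : Fin d → ℕ) (ha : ∀ i, a i ≠ 0) :
    IsSOP R (fun i => x i ^ a i) := by
  refine ⟨hx.1, le_antisymm ?_ ?_⟩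
  · rw [← hx.2]
    apply Ideal.radical_mono
    rw [Ideal.span_le]
    rintro _ ⟨i, rfl⟩
    have h1 : x i ∈ Ideal.span (Set.range x) := Ideal.subset_span ⟨i, rfl⟩
    exact Ideal.pow_mem_of_mem _ h1 _ (Nat.pos_of_ne_zero (ha i))
  · rw [← hx.2, ← Ideal.radical_idem (Ideal.span (Set.range fun i => x i ^ a i))]
    apply Ideal.radical_mono
    rw [Ideal.span_le]
    rintro _ ⟨i, rfl⟩
    have h1 : x i ^ a i ∈ Ideal.span (Set.range fun i => x i ^ a i) :=
      Ideal.subset_span ⟨i, rfl⟩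
    exact Ideal.mem_radical_iff.2 ⟨a i, h1⟩

lemma colon_step (hB : IsBalancedBigCM R B) {d : ℕ} (x : Fin d → R) (hx : IsSOP R x)
    (a : Fin d → ℕ) (ha : ∀ i, a i ≠ 0) (i : Fin d) (s : ℕ) (b : B)
    (hb : algebraMap R B (x i) ^ s * b ∈
      Ideal.span (Set.range fun j => algebraMap R B (x j) ^ Function.update a i (a i + s) j)) :
    b ∈ Ideal.span (Set.range fun j => algebraMap R B (x j) ^ a j) := by
  by_cases hs : s = 0
  · subst hs; simpa using hb
  have hsub : (Set.range fun j => algebraMap R B (x j) ^ Function.update a i (a i + s) j) ⊆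
      insert (algebraMap R B (x i) ^ (a i + s))
        ((fun j => algebraMap R B (x j ^ Function.update a i s j)) '' {i}ᶜ) := by
    rintro _ ⟨j, rfl⟩
    by_cases hj : j = i
    · subst hj; left; simp
    · right
      exact ⟨j, hj, by simp [hj]⟩
  have hb' := Ideal.span_mono hsub hb
  rw [Ideal.mem_span_insert] at hb'
  obtain ⟨v, z, hz, hbz⟩ := hb'
  have h1 : algebraMap R B (x i ^ Function.update a i s i) * (b - algebraMap R B (x i) ^ a i * v) = z := by
    simp only [Function.update_self, map_pow]
    linear_combination hbz
  have h2 := reg_any hB (fun j => x j ^ Function.update a i s j)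
    (sop_pow x hx _ (by
      intro j
      by_cases hj : j = i
      · subst hj; simpa using hs
      · simpa [hj] using ha j)) i _ (by rw [h1]; exact hz)
  have h3 : Ideal.span ((fun j => algebraMap R B (x j ^ Function.update a i s j)) '' {i}ᶜ) ≤
      Ideal.span (Set.range fun j => algebraMap R B (x j) ^ a j) := by
    apply Ideal.span_mono
    rintro _ ⟨j, hj, rfl⟩
    have hj : j ≠ i := hj
    exact ⟨j, by simp [hj]⟩
  have h4 := h3 h2
  have h5 : algebraMap R B (x i) ^ a i * v ∈
      Ideal.span (Set.range fun j => algebraMap R B (x j) ^ a j) :=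
    Ideal.mul_mem_right _ _ (Ideal.subset_span ⟨i, rfl⟩)
  have := add_mem h4 h5
  simpa using this

lemma colon_prod (hB : IsBalancedBigCM R B) {d : ℕ} (x : Fin d → R) (hx : IsSOP R x)
    (t s : ℕ) (ht : t ≠ 0) (b : B)
    (hb : (∏ i, algebraMap R B (x i)) ^ s * b ∈
      Ideal.span (Set.range fun j => algebraMap R B (x j) ^ (t + s))) :
    b ∈ Ideal.span (Set.range fun j => algebraMap R B (x j) ^ t) := by
  classical
  have key : ∀ S : Finset (Fin d), ∀ b : B, (∏ i ∈ S, algebraMap R B (x i) ^ s) * b ∈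
      Ideal.span (Set.range fun j => algebraMap R B (x j) ^ (if j ∈ S then t + s else t)) →
      b ∈ Ideal.span (Set.range fun j => algebraMap R B (x j) ^ t) := by
    intro S
    induction S using Finset.induction_on with
    | empty => intro b hb; simpa using hb
    | insert i S hi ih =>
      intro b hb
      apply ih
      apply colon_step hB x hx (fun j => if j ∈ S then t + s else t)
        (by intro j; split_ifs <;> omega) i s
      rw [Finset.prod_insert hi, mul_assoc] at hb
      convert hb using 6 with j
      by_cases hj : j = i
      · subst hj; simp [hi]
      · simp [hj]
  apply key Finset.univ
  simpa [Finset.prod_pow] using hb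

lemma exists_not_mem [IsNoetherianRing R] [IsDomain R] (hB : IsBalancedBigCM R B) {d : ℕ}
    (x : Fin d → R) (hx : IsSOP R x) (c : R) (hc : c ≠ 0) :
    ∃ t : ℕ, t ≠ 0 ∧
      algebraMap R B c ∉ Ideal.span (Set.range fun j => algebraMap R B (x j) ^ t) := by
  have hxm : ∀ i, x i ∈ maximalIdeal R := fun i => by
    rw [← hx.2]; exact Ideal.le_radical (Ideal.subset_span ⟨i, rfl⟩)
  have hm1 : (1 : B) ∉ (maximalIdeal R).map (algebraMap R B) := by
    rw [← Ideal.ne_top_iff_one]; exact hB.2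
  by_cases hcm : c ∈ maximalIdeal R
  · obtain ⟨e, z, hz⟩ := exists_sop_snoc R c hc hcm
    have hz2 := sop_pow _ hz (Fin.snoc (α := fun _ => ℕ) (fun _ => 1) 2) (by
      intro i
      refine Fin.lastCases ?_ (fun i => ?_) i <;> simp)
    obtain ⟨t, ht⟩ := Ideal.exists_pow_le_of_le_radical_of_fg hz2.2.ge (IsNoetherian.noetherian _)
    refine ⟨t + 1, by omega, fun hmem => ?_⟩
    have h1 : Ideal.span (Set.range fun j => algebraMap R B (x j) ^ (t + 1)) ≤
        Ideal.span (insert (algebraMap R B c ^ 2) (Set.range fun i => algebraMap R B (z i))) := by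
      rw [Ideal.span_le]
      rintro _ ⟨j, rfl⟩
      have h2 : x j ^ (t + 1) ∈ Ideal.span (Set.range fun i =>
          (Fin.snoc (α := fun _ => R) z c : Fin (e + 1) → R) i ^
            (Fin.snoc (α := fun _ => ℕ) (fun _ => 1) 2 : Fin (e + 1) → ℕ) i) := by
        rw [pow_succ]
        exact Ideal.mul_mem_right _ _ (ht (Ideal.pow_mem_pow (hxm j) t))
      have h3 := Ideal.mem_map_of_mem (algebraMap R B) h2
      rw [map_pow, Ideal.map_span] at h3
      refine Ideal.span_mono ?_ h3
      rintro _ ⟨_, ⟨i, rfl⟩, rfl⟩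
      refine Fin.lastCases ?_ (fun i => ?_) i
      · left; simp
      · right; exact ⟨i, by simp⟩
    have h2 := h1 hmem
    rw [Ideal.mem_span_insert] at h2
    obtain ⟨v, w, hw, hvw⟩ := h2
    have h3 := reg_last hB z c hz (1 - algebraMap R B c * v) (by
      have : algebraMap R B c * (1 - algebraMap R B c * v) = w := by linear_combination hvw
      rw [this]; exact hw)
    have hzm : ∀ i, z i ∈ maximalIdeal R := fun i => by
      rw [← hz.2]; exact Ideal.le_radical (Ideal.subset_span ⟨i.castSucc, by simp⟩)
    apply hm1
    have h4 : Ideal.span (Set.range fun i => algebraMap R B (z i)) ≤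
        (maximalIdeal R).map (algebraMap R B) := by
      rw [Ideal.span_le]
      rintro _ ⟨i, rfl⟩
      exact Ideal.mem_map_of_mem _ (hzm i)
    have h5 : algebraMap R B c * v ∈ (maximalIdeal R).map (algebraMap R B) :=
      Ideal.mul_mem_right _ _ (Ideal.mem_map_of_mem _ hcm)
    have := add_mem (h4 h3) h5
    simpa using this
  · have hu : IsUnit c := by simpa using hcm
    refine ⟨1, one_ne_zero, fun h => hm1 ?_⟩
    have h4 : Ideal.span (Set.range fun i => algebraMap R B (x i) ^ 1) ≤
        (maximalIdeal R).map (algebraMap R B) := by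
      rw [Ideal.span_le]
      rintro _ ⟨i, rfl⟩
      simpa using Ideal.mem_map_of_mem _ (hxm i)
    have := Ideal.eq_top_of_isUnit_mem _ (h4 h) (hu.map _)
    rw [this]; trivial

end
end BCM

namespace BCM

lemma mem_intClSet_of_module {R : Type*} [CommRing R] [Nontrivial R] (I : Ideal R) (y : R)
    (M : Type*) [AddCommGroup M] [Module R M] [Module.Finite R M]
    (hf : ∀ c : R, c ≠ 0 → ∃ w : M, c • w ≠ 0)
    (hy : ∀ w : M, y • w ∈ (I • ⊤ : Submodule R M)) : y ∈ intClSet R I := by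
  obtain ⟨p, hp, -, hc, ha⟩ :=
    LinearMap.exists_monic_and_natDegree_eq_and_coeff_mem_pow_and_aeval_eq_zero R
      (LinearMap.lsmul R M y) I (by rintro _ ⟨w, rfl⟩; exact hy w)
  have h0 : p.eval y = 0 := by
    by_contra h
    obtain ⟨w, hw⟩ := hf _ h
    apply hw
    have h1 : LinearMap.lsmul R M y = algebraMap R (Module.End R M) y := by
      ext w; simp
    rw [h1, Polynomial.aeval_algebraMap_apply_eq_algebraMap_eval] at ha
    have := LinearMap.congr_fun ha w
    simpa using this
  have hn : 0 < p.natDegree := by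
    rw [Nat.pos_iff_ne_zero]
    intro h
    rw [hp.natDegree_eq_zero] at h
    rw [h] at h0
    simp at h0
  refine ⟨p.natDegree, hn, fun k => p.coeff (p.natDegree - k), ?_, ?_⟩
  · intro k hk
    rw [Finset.mem_Icc] at hk
    have := hc (p.natDegree - k)
    rwa [Nat.sub_sub_self hk.2] at this
  · rw [Polynomial.eval_eq_sum_range, Finset.sum_range_succ, hp.coeff_natDegree, one_mul,
      ← Finset.sum_range_reflect] at h0
    rw [← h0, add_comm]
    congr 1
    have hI : Finset.Icc 1 p.natDegree = Finset.Ico 1 (p.natDegree + 1) := by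
      ext k; simp only [Finset.mem_Icc, Finset.mem_Ico]; omega
    rw [hI, Finset.sum_Ico_eq_sum_range, Nat.add_sub_cancel]
    refine Finset.sum_congr rfl fun k _ => ?_
    rw [Nat.sub_sub]

section
variable {R : Type*} [CommRing R] {B : Type*} [CommRing B] [Algebra R B]
  {d : ℕ} (x : Fin d → R) (L : Type*) [CommRing L] [Algebra B L]

lemma mul_pow_mem (t s : ℕ) (b : B)
    (hb : b ∈ Ideal.span (Set.range fun j => algebraMap R B (x j) ^ t)) :
    (∏ i, algebraMap R B (x i)) ^ s * b ∈
      Ideal.span (Set.range fun j => algebraMap R B (x j) ^ (t + s)) := by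
  refine Submodule.span_induction (p := fun b _ => (∏ i, algebraMap R B (x i)) ^ s * b ∈
      Ideal.span (Set.range fun j => algebraMap R B (x j) ^ (t + s))) ?_ ?_ ?_ ?_ hb
  · rintro _ ⟨j, rfl⟩
    have h1 : algebraMap R B (x j) ^ (t + s) ∈
      Ideal.span (Set.range fun j => algebraMap R B (x j) ^ (t + s)) :=
      Ideal.subset_span ⟨j, rfl⟩
    refine Ideal.mem_of_dvd _ ?_ h1
    rw [pow_add, mul_comm]
    exact mul_dvd_mul (pow_dvd_pow_of_dvd (Finset.dvd_prod_of_mem _ (Finset.mem_univ j)) s) dvd_rfl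
  · simp
  · intro a b _ _ ha hb
    rw [mul_add]; exact add_mem ha hb
  · intro a b _ hb
    rw [smul_eq_mul, mul_left_comm]; exact Ideal.mul_mem_left _ _ hb

/-- The submodule of fractions with zero local cohomology class. -/
def Dsub : Submodule B L where
  carrier := {z | ∃ t : ℕ, ∃ b ∈ Ideal.span (Set.range fun j => algebraMap R B (x j) ^ t),
    z * algebraMap B L (∏ i, algebraMap R B (x i)) ^ t = algebraMap B L b}
  zero_mem' := ⟨0, 0, zero_mem _, by simp⟩
  add_mem' := by
    rintro z w ⟨t, b, hb, hz⟩ ⟨s, c, hc, hw⟩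
    refine ⟨t + s, (∏ i, algebraMap R B (x i)) ^ s * b + (∏ i, algebraMap R B (x i)) ^ t * c,
      add_mem (mul_pow_mem x t s b hb) ?_, ?_⟩
    · rw [add_comm t s]; exact mul_pow_mem x s t c hc
    · rw [map_add, map_mul, map_mul, ← hz, ← hw, map_pow, map_pow]
      ring
  smul_mem' := by
    rintro a z ⟨t, b, hb, hz⟩
    refine ⟨t, a * b, Ideal.mul_mem_left _ _ hb, ?_⟩
    rw [map_mul, ← hz, Algebra.smul_def, mul_assoc]

variable {L}

lemma u_mem (v : Fin d → L) (hv : ∀ i, algebraMap B L (algebraMap R B (x i)) * v i = 1)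
    (n : Fin d → ℕ) (i : Fin d) (hn : n i = 0) : ∏ j, v j ^ n j ∈ Dsub (B := B) x L := by
  refine ⟨∑ j, n j, ∏ j, algebraMap R B (x j) ^ ((∑ j, n j) - n j), ?_, ?_⟩
  · have h1 : algebraMap R B (x i) ^ (∑ j, n j) ∈
      Ideal.span (Set.range fun j => algebraMap R B (x j) ^ (∑ j, n j)) :=
      Ideal.subset_span ⟨i, rfl⟩
    refine Ideal.mem_of_dvd _ ?_ h1
    have := Finset.dvd_prod_of_mem (fun j => algebraMap R B (x j) ^ ((∑ j, n j) - n j))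
      (Finset.mem_univ i)
    simpa [hn] using this
  · rw [map_prod, map_prod, ← Finset.prod_pow, ← Finset.prod_mul_distrib]
    refine Finset.prod_congr rfl fun j _ => ?_
    have h : n j ≤ ∑ j, n j := Finset.single_le_sum (fun _ _ => Nat.zero_le _) (Finset.mem_univ j)
    obtain ⟨k, hk⟩ := Nat.exists_eq_add_of_le h
    rw [hk, Nat.add_sub_cancel_left, pow_add, ← mul_assoc, ← mul_pow, mul_comm (v j), hv, one_pow,
      one_mul, map_pow]

lemma u_step (v : Fin d → L) (hv : ∀ i, algebraMap B L (algebraMap R B (x i)) * v i = 1)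
    (n : Fin d → ℕ) (i : Fin d) :
    algebraMap B L (algebraMap R B (x i)) * ∏ j, v j ^ (n + Pi.single i 1 : Fin d → ℕ) j =
      ∏ j, v j ^ n j := by
  have : ∏ j, v j ^ (Pi.single i 1 : Fin d → ℕ) j = v i := by
    rw [Finset.prod_eq_single i]
    · simp
    · intro j _ hj; simp [hj]
    · simp
  simp only [Pi.add_apply, pow_add, Finset.prod_mul_distrib]
  rw [this, mul_left_comm, hv, mul_one]

lemma not_mem_D [IsLocalRing R] (hB : IsBalancedBigCM R B) (hx : IsSOP R x)
    [IsLocalization.Away (∏ i, algebraMap R B (x i)) L]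
    (v : Fin d → L) (hv : ∀ i, algebraMap B L (algebraMap R B (x i)) * v i = 1)
    (t : ℕ) (ht : t ≠ 0) (c : B)
    (hc : c ∉ Ideal.span (Set.range fun j => algebraMap R B (x j) ^ t)) :
    algebraMap B L c * ∏ j, v j ^ t ∉ Dsub (B := B) x L := by
  rintro ⟨s, b, hb, h⟩
  apply hc
  have h1 : algebraMap B L ((∏ i, algebraMap R B (x i)) ^ s * c) =
      algebraMap B L ((∏ i, algebraMap R B (x i)) ^ t * b) := by
    have h2 : algebraMap B L (∏ i, algebraMap R B (x i)) ^ t * ∏ j, v j ^ t = 1 := by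
      rw [map_prod, ← Finset.prod_pow, ← Finset.prod_mul_distrib]
      refine Finset.prod_eq_one fun j _ => ?_
      rw [← mul_pow, hv, one_pow]
    rw [map_mul, map_mul, ← h, map_pow, map_pow]
    linear_combination (-algebraMap B L c * algebraMap B L (∏ i, algebraMap R B (x i)) ^ s) * h2
  rw [IsLocalization.eq_iff_exists (Submonoid.powers (∏ i, algebraMap R B (x i)))] at h1
  obtain ⟨⟨_, ⟨k, rfl⟩⟩, h3⟩ := h1
  apply colon_prod hB x hx t (k + s) ht
  have h4 := mul_pow_mem x s (k + t) b hb
  have h5 : (∏ i, algebraMap R B (x i)) ^ (k + s) * c =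
    (∏ i, algebraMap R B (x i)) ^ (k + t) * b := by
    rw [pow_add, pow_add]
    linear_combination h3
  rw [h5]
  have h6 : t + (k + s) = s + (k + t) := by ring
  rw [h6]; exact h4

end

lemma core (R : Type u) [CommRing R] [IsLocalRing R] [IsNoetherianRing R] [IsDomain R]
    [IsPrecomplete (maximalIdeal R) R]
    (B : Type u) [CommRing B] [Algebra R B] (hB : IsBalancedBigCM R B)
    (I : Ideal R) (y : R) (hy : algebraMap R B y ∈ I.map (algebraMap R B)) :
    y ∈ intClSet R I := by
  obtain ⟨d, x, hx⟩ := exists_sop R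
  obtain ⟨W, _, _, e, he0, hsoc, hsep⟩ := exists_W R
  have hxm : ∀ i, x i ∈ maximalIdeal R := fun i => by
    rw [← hx.2]; exact Ideal.le_radical (Ideal.subset_span ⟨i, rfl⟩)
  have hbase := tate_base (W := W) (maximalIdeal R) e hsoc x hx.2.ge
  have hfin : Module.Finite R (tate x W ∅) := tate_finite (maximalIdeal R) x hx.2.ge hxm hbase
  let X : B := ∏ i, algebraMap R B (x i)
  let L := Localization.Away X
  have hXu : IsUnit (algebraMap B L X) := IsLocalization.Away.algebraMap_isUnit X
  have hv0 : ∀ i, ∃ v : L, algebraMap B L (algebraMap R B (x i)) * v = 1 := fun i => by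
    have : IsUnit (algebraMap B L (algebraMap R B (x i))) := by
      refine isUnit_of_dvd_unit ?_ hXu
      exact map_dvd _ (Finset.dvd_prod_of_mem _ (Finset.mem_univ i))
    exact this.exists_right_inv
  choose v hv using hv0
  let un : (Fin d → ℕ) → L := fun n => ∏ j, v j ^ n j
  let D : Submodule B L := Dsub x L
  let H : Submodule R (L →ₗ[R] W) :=
    { carrier := {Ψ | ∀ z ∈ D, Ψ z = 0}
      zero_mem' := fun z _ => rfl
      add_mem' := fun {a b} ha hb z hz => by
        rw [LinearMap.add_apply, ha z hz, hb z hz, add_zero]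
      smul_mem' := fun r a ha z hz => by
        rw [LinearMap.smul_apply, ha z hz, smul_zero] }
  let ev : (L →ₗ[R] W) →ₗ[R] ((Fin d → ℕ) → W) := LinearMap.pi fun n => LinearMap.applyₗ (un n)
  have hev : ∀ Ψ n, ev Ψ n = Ψ (un n) := fun _ _ => rfl
  have hsm : ∀ (r : R) (z : L), r • z = algebraMap B L (algebraMap R B r) * z := fun r z => by
    rw [← IsScalarTower.algebraMap_apply, Algebra.smul_def]
  let M := H.map ev
  have hM : M ≤ tate x W ∅ := by
    rintro _ ⟨Ψ, hΨ, rfl⟩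
    refine ⟨fun i hi => absurd hi (Finset.notMem_empty i), fun i _ n => ⟨fun hn => ?_, ?_⟩⟩
    · exact hΨ _ (u_mem x v hv n i hn)
    · rw [hev, hev, ← map_smul, hsm]
      exact congrArg Ψ (u_step x v hv n i)
  have hMfin : Module.Finite R M := by
    have : IsNoetherian R (tate x W ∅) := inferInstance
    exact Module.Finite.iff_fg.2 (isNoetherian_submodule.1 this M hM)
  let mB : B → (L →ₗ[R] L) := fun b => LinearMap.mulLeft R (algebraMap B L b)
  have hmB : ∀ b, ∀ Ψ ∈ H, Ψ ∘ₗ mB b ∈ H := fun b Ψ hΨ z hz => by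
    apply hΨ
    change algebraMap B L b * z ∈ D
    rw [← Algebra.smul_def]
    exact D.smul_mem b hz
  have key : ∀ b ∈ I.map (algebraMap R B), ∀ Ψ ∈ H, ev (Ψ ∘ₗ mB b) ∈ I • M := by
    intro b hb
    refine Submodule.span_induction (p := fun b _ => ∀ Ψ ∈ H, ev (Ψ ∘ₗ mB b) ∈ I • M)
      ?_ ?_ ?_ ?_ hb
    · rintro _ ⟨r, hr, rfl⟩ Ψ hΨ
      have : ev (Ψ ∘ₗ mB (algebraMap R B r)) = r • ev Ψ := by
        funext n
        change Ψ (algebraMap B L (algebraMap R B r) * un n) = r • Ψ (un n)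
        rw [← hsm, map_smul]
      rw [this]
      exact Submodule.smul_mem_smul hr ⟨Ψ, hΨ, rfl⟩
    · intro Ψ _
      have : ev (Ψ ∘ₗ mB 0) = 0 := by
        funext n
        change Ψ (algebraMap B L 0 * un n) = 0
        simp
      rw [this]; exact zero_mem _
    · intro a b _ _ ha hb Ψ hΨ
      have : ev (Ψ ∘ₗ mB (a + b)) = ev (Ψ ∘ₗ mB a) + ev (Ψ ∘ₗ mB b) := by
        funext n
        change Ψ (algebraMap B L (a + b) * un n) =
          Ψ (algebraMap B L a * un n) + Ψ (algebraMap B L b * un n)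
        rw [map_add, add_mul, map_add]
      rw [this]; exact add_mem (ha Ψ hΨ) (hb Ψ hΨ)
    · intro a b _ hb Ψ hΨ
      have : ev (Ψ ∘ₗ mB (a • b)) = ev ((Ψ ∘ₗ mB a) ∘ₗ mB b) := by
        funext n
        change Ψ (algebraMap B L (a • b) * un n) =
          Ψ (algebraMap B L a * (algebraMap B L b * un n))
        rw [smul_eq_mul, map_mul (algebraMap B L), mul_assoc]
      rw [this]; exact hb _ (hmB a Ψ hΨ)
  refine mem_intClSet_of_module I y M ?_ ?_
  · intro c hc
    obtain ⟨t, ht, hct⟩ := exists_not_mem hB x hx c hc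
    have h1 := not_mem_D (L := L) x hB hx v hv t ht _ hct
    obtain ⟨Ψ, hΨ, hη⟩ := hsep L (D.restrictScalars R) _ h1
    refine ⟨⟨ev Ψ, Ψ, hΨ, rfl⟩, fun h => he0 ?_⟩
    have h2 := congrFun (congrArg Subtype.val h) (fun _ => t)
    change c • Ψ (∏ j, v j ^ t) = 0 at h2
    rw [← map_smul, hsm, hη] at h2
    exact h2
  · rintro ⟨_, Ψ, hΨ, rfl⟩
    rw [Submodule.mem_smul_top_iff]
    have := key _ hy Ψ hΨ
    have h2 : ev (Ψ ∘ₗ mB (algebraMap R B y)) = y • ev Ψ := by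
      funext n
      change Ψ (algebraMap B L (algebraMap R B y) * un n) = y • Ψ (un n)
      rw [← hsm, map_smul]
    rw [h2] at this
    exact this

end BCM

/-- For a Noetherian complete local domain `R`, every balanced big Cohen–Macaulay
`R`-algebra `B` satisfies `IB ∩ R ⊆ ī` for all ideals `I ⊆ R`. -/
theorem stmt6 (R : Type u) [CommRing R] [IsLocalRing R] [IsNoetherianRing R] [IsDomain R]
    (hcomp : IsAdicComplete (maximalIdeal R) R)
    (B : Type u) [CommRing B] [Algebra R B] (hB : IsBalancedBigCM R B)
    (I : Ideal R) :
    (contractedExt R (algebraMap R B) I : Set R) ⊆ intClSet R I := by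
  intro y hy
  have := hcomp.toIsPrecomplete
  exact BCM.core R B hB I y hy
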